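/- Let u : 𝒜 × ℝ → ℝ be a quasi-linear utility function and let u' : 𝒜 × ℝ → ℝ be a utility function such that for each a ∈ 𝒜 the map z ↦ u'(a, z) is continuous and strictly decreasing, and such that u'(a, z) = u(a, z) whenever u(a, z) ≥ min_{a' ∈ 𝒜} u(a', 0). Then u' is a parallel utility function. -/

import Mathlib

def QuasiLinear {𝒜 : Type*} (u : 𝒜 × ℝ → ℝ) : Prop :=
  ∃ v : 𝒜 → ℝ, ∀ (a : 𝒜) (z : ℝ), u (a, z) = v a - z

/-- `min_{a' ∈ 𝒜} u (a', 0)`. -/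
noncomputable def minAtZero {𝒜 : Type*} [Fintype 𝒜] [Nonempty 𝒜] (u : 𝒜 × ℝ → ℝ) : ℝ :=
  Finset.univ.inf' Finset.univ_nonempty (fun a => u (a, 0))

/-- Parallel utility functions (Ma et al.). -/
def Parallel {𝒜 : Type*} [Fintype 𝒜] [Nonempty 𝒜] (u : 𝒜 × ℝ → ℝ) : Prop :=
  (∀ a : 𝒜, Continuous fun z => u (a, z)) ∧
  (∀ a : 𝒜, StrictAnti fun z => u (a, z)) ∧
  (∀ a : 𝒜, ∃ L : EReal, Filter.Tendsto (fun z => ((u (a, z) : ℝ) : EReal))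
      Filter.atTop (nhds L) ∧ L < ((minAtZero u : ℝ) : EReal)) ∧
  (∀ a b : 𝒜, u (b, 0) ≤ u (a, 0) →
    ∀ ta tb : ℝ, u (a, ta) = minAtZero u → u (b, tb) = minAtZero u →
      ∀ z : ℝ, 0 ≤ z → minAtZero u ≤ u (b, z) → u (a, z + (ta - tb)) = u (b, z))

theorem stmt14 {𝒜 : Type*} [Fintype 𝒜] [Nonempty 𝒜] (u u' : 𝒜 × ℝ → ℝ)
    (hu : QuasiLinear u)
    (hcont : ∀ a : 𝒜, Continuous fun z => u' (a, z))
    (hanti : ∀ a : 𝒜, StrictAnti fun z => u' (a, z))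
    (hcoincide : ∀ (a : 𝒜) (z : ℝ), minAtZero u ≤ u (a, z) → u' (a, z) = u (a, z)) :
    Parallel u' := by
  obtain ⟨v, hv⟩ := hu
  have h0 : ∀ a, u' (a, 0) = u (a, 0) := fun a =>
    hcoincide a 0 (Finset.inf'_le (fun a => u (a, 0)) (Finset.mem_univ a))
  have hm : minAtZero u' = minAtZero u := by
    unfold minAtZero
    simp only [h0]
  have ht : ∀ a, u' (a, v a - minAtZero u) = minAtZero u := by
    intro a
    have h1 : u (a, v a - minAtZero u) = minAtZero u := by rw [hv]; ring
    rw [hcoincide a _ h1.ge, h1]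
  refine ⟨hcont, hanti, ?_, ?_⟩
  · intro a
    have hmono : Antitone fun z => ((u' (a, z) : ℝ) : EReal) := fun x y hxy =>
      EReal.coe_le_coe_iff.2 ((hanti a).antitone hxy)
    refine ⟨_, tendsto_atTop_iInf hmono, ?_⟩
    refine lt_of_le_of_lt (iInf_le _ (v a - minAtZero u + 1)) ?_
    rw [hm, EReal.coe_lt_coe_iff]
    have h := hanti a (lt_add_one (v a - minAtZero u))
    simp only [ht] at h
    exact h
  · intro a b _ ta tb hta htb z _ hz
    rw [hm] at hta htb hz
    have ea : ta = v a - minAtZero u := (hanti a).injective (hta.trans (ht a).symm)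
    have eb : tb = v b - minAtZero u := (hanti b).injective (htb.trans (ht b).symm)
    have hzb : z ≤ v b - minAtZero u := by
      refine (hanti b).le_iff_ge.1 ?_
      simp only [ht]
      exact hz
    have h1 : u (a, z + (ta - tb)) = v b - z := by rw [hv, ea, eb]; ring
    rw [hcoincide a _ (by rw [h1]; linarith), hcoincide b z (by rw [hv]; linarith), h1, hv]
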